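/- (Exact sample likelihood for the linear regression model, equation (eq:LRp_s).) Let m ∈ ℝ, σ_y > 0, κ_y ∈ ℝ, c ∈ ℝ, σ_π > 0. Define the joint population density f(y, π) = lognormalPDF(π; κ_y y + c, σ_π²) · φ(y; m, σ_y²) and Z = ∫_ℝ ∫₀^∞ π f(y, π) dπ dy. Then for every y ∈ ℝ and π > 0, π f(y, π)/Z = [φ(log π; κ_y y + c, σ_π²) / exp(c + σ_π²/2 + κ_y m + κ_y² σ_y²/2)] · φ(y; m, σ_y²). -/

import Mathlib

open MeasureTheory Real

/-- The lognormal probability density with parameters `μ` and `σ²`. -/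
noncomputable def lognormalPDF (μ σ x : ℝ) : ℝ :=
  if 0 < x then (x * σ * Real.sqrt (2 * Real.pi))⁻¹ *
    Real.exp (-(Real.log x - μ) ^ 2 / (2 * σ ^ 2)) else 0

/-- The normal probability density with mean `μ` and variance `σ²`. -/
noncomputable def normalPDF (μ σ t : ℝ) : ℝ :=
  (σ * Real.sqrt (2 * Real.pi))⁻¹ * Real.exp (-(t - μ) ^ 2 / (2 * σ ^ 2))

theorem integral_normalPDF_eq_one (μ σ : ℝ) (hσ : 0 < σ) : ∫ t, normalPDF μ σ t = 1 := by
  obtain ⟨v, hv2⟩ : ∃ v : NNReal, (v : ℝ) = σ ^ 2 := ⟨⟨σ ^ 2, sq_nonneg σ⟩, rfl⟩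
  have hv : v ≠ 0 := by
    intro h
    rw [h, NNReal.coe_zero] at hv2
    exact (pow_pos hσ 2).ne hv2
  rw [← ProbabilityTheory.integral_gaussianPDFReal_eq_one μ hv]
  congr 1
  ext t
  simp only [ProbabilityTheory.gaussianPDFReal_def, normalPDF, hv2]
  rw [mul_comm (2 * π) (σ ^ 2), Real.sqrt_mul (sq_nonneg σ), Real.sqrt_sq hσ.le]

theorem integral_exp_mul_normalPDF (a μ σ : ℝ) (hσ : 0 < σ) :
    ∫ t, Real.exp (a * t) * normalPDF μ σ t = Real.exp (a * μ + a ^ 2 * σ ^ 2 / 2) := by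
  have h : ∀ t, Real.exp (a * t) * normalPDF μ σ t =
      Real.exp (a * μ + a ^ 2 * σ ^ 2 / 2) * normalPDF (μ + a * σ ^ 2) σ t := by
    intro t
    unfold normalPDF
    rw [mul_left_comm, mul_left_comm (Real.exp (a * μ + a ^ 2 * σ ^ 2 / 2)),
      ← Real.exp_add, ← Real.exp_add]
    congr 2
    field_simp
    ring
  simp_rw [h]
  rw [integral_const_mul, integral_normalPDF_eq_one _ _ hσ, mul_one]

theorem mul_lognormalPDF (μ σ t : ℝ) (ht : 0 < t) :
    t * lognormalPDF μ σ t = normalPDF μ σ (Real.log t) := by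
  rw [lognormalPDF, if_pos ht, normalPDF, mul_assoc t, mul_inv, mul_assoc, ← mul_assoc,
    mul_inv_cancel₀ ht.ne', one_mul]

theorem integral_mul_lognormalPDF (μ σ : ℝ) (hσ : 0 < σ) :
    ∫ t in Set.Ioi (0 : ℝ), t * lognormalPDF μ σ t = Real.exp (μ + σ ^ 2 / 2) := by
  have h := integral_image_eq_integral_abs_deriv_smul (s := Set.univ) (f := Real.exp)
    (f' := Real.exp) MeasurableSet.univ (fun x _ => (Real.hasDerivAt_exp x).hasDerivWithinAt)
    Real.exp_injective.injOn (fun t => t * lognormalPDF μ σ t)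
  rw [Set.image_univ, Real.range_exp] at h
  rw [h, setIntegral_univ]
  have h2 := integral_exp_mul_normalPDF 1 μ σ hσ
  simp only [one_mul, one_pow] at h2
  rw [← h2]
  congr 1
  ext x
  rw [mul_lognormalPDF _ _ _ (Real.exp_pos x), Real.log_exp, abs_of_pos (Real.exp_pos x),
    smul_eq_mul]

/-- Exact sample likelihood for the linear regression model (equation (eq:LRp_s)):
with `f(y, t) = lognormalPDF(t; κ_y y + c, σ_π²) φ(y; m, σ_y²)` and
`Z = ∫ ∫₀^∞ t f(y,t) dt dy`, for every `y` and `t > 0`,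
`t f(y,t)/Z = [φ(log t; κ_y y + c, σ_π²) / exp(c + σ_π²/2 + κ_y m + κ_y² σ_y²/2)] φ(y; m, σ_y²)`. -/
theorem exact_sample_likelihood_linear_regression
    (m σy κy c σπ : ℝ) (hσy : 0 < σy) (hσπ : 0 < σπ)
    (f : ℝ → ℝ → ℝ)
    (hf : ∀ y t, f y t = lognormalPDF (κy * y + c) σπ t * normalPDF m σy y)
    (Z : ℝ) (hZ : Z = ∫ y, ∫ t in Set.Ioi (0 : ℝ), t * f y t) :
    ∀ y t, 0 < t →
      t * f y t / Z =
        normalPDF (κy * y + c) σπ (Real.log t) /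
          Real.exp (c + σπ ^ 2 / 2 + κy * m + κy ^ 2 * σy ^ 2 / 2) * normalPDF m σy y := by
  have hZ' : Z = Real.exp (c + σπ ^ 2 / 2 + κy * m + κy ^ 2 * σy ^ 2 / 2) := by
    rw [hZ]
    have h : ∀ y, ∫ t in Set.Ioi (0 : ℝ), t * f y t =
        Real.exp (c + σπ ^ 2 / 2) * (Real.exp (κy * y) * normalPDF m σy y) := by
      intro y
      simp_rw [hf, ← mul_assoc]
      rw [integral_mul_const, integral_mul_lognormalPDF _ _ hσπ, ← Real.exp_add]
      congr 2
      ring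
    simp_rw [h]
    rw [integral_const_mul, integral_exp_mul_normalPDF _ _ _ hσy, ← Real.exp_add]
    congr 1
    ring
  intro y t ht
  rw [hZ', hf, ← mul_assoc, mul_lognormalPDF _ _ _ ht]
  ring
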